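/- Let m, n, ℓ, ñ be integers with m ≥ 6, n ≥ m, 0 ≤ ℓ ≤ m, ñ ≥ 1 and 4mñ < m², and set Δ = 4mn − ℓ². Then Σ_{ℓ̃: 0 ≤ ℓ̃ < m, 4mñ − ℓ̃² < 0} 2·c_m^F(ñ, ℓ̃)·(ℓ̃² − 4mñ)^{23/4}·I_{23/2}(π√(Δ(ℓ̃² − 4mñ))/m) < 0.23·c_m^F(ñ, m)·(m² − 4mñ)^{23/4}·I_{23/2}(π√(Δ(m² − 4mñ))/m). -/

import Mathlib

open Real

/-- The modified Bessel function of the first kind. -/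
noncomputable def besselI (ν x : ℝ) : ℝ :=
  ∑' k : ℕ, (x / 2) ^ (2 * (k : ℝ) + ν) / ((k.factorial : ℝ) * Real.Gamma ((k : ℝ) + ν + 1))

/-- `d n`: the coefficient of `q^(n+1)` in `∏ (1 - q^j)^{-24}`. -/
def dcoef (n : ℤ) : ℤ :=
  if 0 ≤ n + 1 then
    ∑ v ∈ Finset.Nat.antidiagonalTuple 24 (n + 1).toNat,
      ∏ i, (Fintype.card (Nat.Partition (v i)) : ℤ)
  else 0

/-- The polar coefficient `c_m^F(ñ, ℓ̃)`, given by the `SL(2,ℤ)` continued-fraction sum. -/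
noncomputable def polarCoef (m nt ℓt : ℤ) : ℤ :=
  ∑ᶠ (p : ℤ) (q : ℤ) (r : ℤ) (s : ℤ),
    if p * s - q * r = 1 ∧ 0 < r ∧ 0 < s ∧
        0 ≤ (ℓt : ℚ) / (2 * m) - (q : ℚ) / s ∧
        (ℓt : ℚ) / (2 * m) - (q : ℚ) / s < 1 / ((r : ℚ) * s) then
      (-2 * r * s * nt - 2 * p * q * m + (p * s + q * r) * ℓt) *
        dcoef (r ^ 2 * nt + p ^ 2 * m - p * r * ℓt) *
        dcoef (s ^ 2 * nt + q ^ 2 * m - q * s * ℓt)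
    else 0

/-- The total number of parts equal to `i` over all partitions of `n`. -/
theorem sum_count_partition (i n : ℕ) (hi : 1 ≤ i) :
    ∑ μ : n.Partition, μ.parts.count i =
      ∑ N ∈ (Finset.Icc 1 n).filter (i ∣ ·), Fintype.card (n - N).Partition := by
  induction n using Nat.strong_induction_on with
  | _ n ih =>
  by_cases hin : i ≤ n
  · have hleft : ∑ μ : n.Partition, μ.parts.count i =
        ∑ μ : (n - i).Partition, (μ.parts.count i + 1) := by
      rw [← Finset.sum_filter_add_sum_filter_not Finset.univ (fun μ : n.Partition => i ∈ μ.parts)]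
      have hzero : ∑ μ : n.Partition with i ∉ μ.parts, μ.parts.count i = 0 :=
        Finset.sum_eq_zero fun μ hμ => by simpa using hμ
      rw [hzero, add_zero, Finset.sum_subtype _ (p := fun μ : n.Partition => i ∈ μ.parts)
        (by simp), ← (Nat.Partition.partitionWithPartEquiv hi hin).symm.sum_comp]
      simp
    have hright : (Finset.Icc 1 n).filter (i ∣ ·) =
        insert i (((Finset.Icc 1 (n - i)).filter (i ∣ ·)).image (· + i)) := by
      ext N
      simp only [Finset.mem_filter, Finset.mem_Icc, Finset.mem_insert, Finset.mem_image]
      constructor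
      · rintro ⟨⟨h1, h2⟩, h3⟩
        by_cases hN : N = i
        · exact Or.inl hN
        · have := Nat.le_of_dvd (by omega) h3
          exact Or.inr ⟨N - i, ⟨⟨by omega, by omega⟩, Nat.dvd_sub h3 dvd_rfl⟩, by omega⟩
      · rintro (rfl | ⟨M, ⟨⟨h1, h2⟩, h3⟩, rfl⟩)
        · exact ⟨⟨hi, hin⟩, dvd_rfl⟩
        · exact ⟨⟨by omega, by omega⟩, by simpa using h3⟩
    rw [hleft, Finset.sum_add_distrib, ih (n - i) (by omega), hright, Finset.sum_insert,
      Finset.sum_image (by simp)]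
    · simp [Nat.sub_sub, add_comm]
    · simp only [Finset.mem_image, Finset.mem_filter, Finset.mem_Icc]
      rintro ⟨M, ⟨⟨h1, h2⟩, h3⟩, h⟩
      omega
  · rw [Finset.sum_eq_zero, Finset.filter_false_of_mem, Finset.sum_empty]
    · intro N hN hd
      have := Nat.le_of_dvd (by simp at hN; omega) hd
      simp at hN
      omega
    · intro μ _
      rw [Multiset.count_eq_zero]
      exact fun h => hin (Nat.Partition.le_of_mem_parts h)

/-- Euler's recurrence `n p(n) = ∑ σ(N) p(n - N)`. -/
theorem mul_card_partition (n : ℕ) :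
    n * Fintype.card n.Partition =
      ∑ N ∈ Finset.Icc 1 n, (∑ i ∈ N.divisors, i) * Fintype.card (n - N).Partition := by
  have h1 : n * Fintype.card n.Partition =
      ∑ i ∈ Finset.Icc 1 n, i * ∑ μ : n.Partition, μ.parts.count i := by
    simp_rw [Finset.mul_sum]
    rw [Finset.sum_comm, Finset.sum_congr rfl (g := fun _ => n)]
    · simp [mul_comm]
    · intro μ _
      conv_rhs => rw [← μ.parts_sum]
      rw [Finset.sum_multiset_count_of_subset μ.parts (Finset.Icc 1 n)]
      · simp [mul_comm]
      · intro i hi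
        rw [Multiset.mem_toFinset] at hi
        exact Finset.mem_Icc.2 ⟨μ.parts_pos hi, Nat.Partition.le_of_mem_parts hi⟩
  rw [h1, Finset.sum_congr rfl fun i hi => by
    rw [sum_count_partition i n (Finset.mem_Icc.1 hi).1, Finset.mul_sum, Finset.sum_filter]]
  rw [Finset.sum_comm]
  refine Finset.sum_congr rfl fun N hN => ?_
  rw [← Finset.sum_filter, ← Finset.sum_mul]
  congr 1
  refine Finset.sum_congr ?_ fun _ _ => rfl
  ext i
  simp only [Finset.mem_Icc, Finset.mem_filter, Nat.mem_divisors] at hN ⊢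
  constructor
  · rintro ⟨_, h⟩
    exact ⟨h, by omega⟩
  · rintro ⟨h, _⟩
    have := Nat.le_of_dvd (by omega) h
    have := Nat.pos_of_dvd_of_pos h (by omega)
    exact ⟨⟨by omega, by omega⟩, h⟩

theorem card_partition_mono (n : ℕ) :
    Fintype.card n.Partition ≤ Fintype.card (n + 1).Partition := by
  have e := Nat.Partition.partitionWithPartEquiv (n := n + 1) (a := 1) le_rfl (by omega)
  exact Fintype.card_le_of_injective (fun μ => (e.symm μ).1)
    (Subtype.val_injective.comp e.symm.injective)

/-- The generating series of the partition numbers. -/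
noncomputable def partitionSeries : PowerSeries ℤ :=
  PowerSeries.mk fun n => (Fintype.card n.Partition : ℤ)

/-- The number of `24`-coloured partitions of `N`. -/
noncomputable def colored (N : ℕ) : ℤ := PowerSeries.coeff N (partitionSeries ^ 24)

/-- The sum of divisors of `N`. -/
def sigmaOne (N : ℕ) : ℤ := ∑ i ∈ N.divisors, (i : ℤ)

theorem dcoef_eq (n : ℤ) : dcoef n = if 0 ≤ n + 1 then colored (n + 1).toNat else 0 := by
  have key (N : ℕ) : ∑ v ∈ Finset.Nat.antidiagonalTuple 24 N,
      ∏ i, (Fintype.card (Nat.Partition (v i)) : ℤ) = colored N := by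
    have hpow : partitionSeries ^ 24 = ∏ _i : Fin 24, partitionSeries := by simp
    rw [colored, hpow, PowerSeries.coeff_prod]
    refine Finset.sum_nbij' (fun v => Finsupp.equivFunOnFinite.symm v) (fun l => l) ?_ ?_ ?_ ?_ ?_
    · intro v hv
      simpa [Finset.Nat.mem_antidiagonalTuple] using hv
    · intro l hl
      simpa [Finset.Nat.mem_antidiagonalTuple] using hl
    · intro v _
      rfl
    · intro l _
      ext
      rfl
    · intro v _
      simp [partitionSeries]
  simp only [dcoef, key]

theorem colored_recurrence (N : ℕ) :
    (N : ℤ) * colored N = 24 * ∑ k ∈ Finset.Icc 1 N, sigmaOne k * colored (N - k) := by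
  have to_icc (S F : ℕ → ℤ) (hS : S 0 = 0) (n : ℕ) :
      PowerSeries.coeff n (PowerSeries.mk S * PowerSeries.mk F) =
        ∑ k ∈ Finset.Icc 1 n, S k * F (n - k) := by
    rw [PowerSeries.coeff_mul, Finset.Nat.sum_antidiagonal_eq_sum_range_succ_mk,
      Finset.sum_range_succ', Finset.range_eq_Ico, Finset.sum_Ico_add' (c := 1)
        (f := fun k => PowerSeries.coeff k (PowerSeries.mk S) *
          PowerSeries.coeff (n - k) (PowerSeries.mk F))]
    simp [hS]
    rfl
  have hD (f : PowerSeries ℤ) (n : ℕ) : PowerSeries.coeff n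
      (PowerSeries.X * PowerSeries.derivative ℤ f) = n * PowerSeries.coeff n f := by
    cases n with
    | zero => simp
    | succ n => simp [PowerSeries.coeff_succ_X_mul, PowerSeries.coeff_derivative, mul_comm]
  have hf : PowerSeries.X * PowerSeries.derivative ℤ partitionSeries =
      PowerSeries.mk sigmaOne * partitionSeries := by
    ext n
    rw [hD, partitionSeries, to_icc _ _ (by simp [sigmaOne])]
    simpa [sigmaOne] using congrArg (Nat.cast : ℕ → ℤ) (mul_card_partition n)
  have hF : PowerSeries.X * PowerSeries.derivative ℤ (partitionSeries ^ 24) =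
      24 * (PowerSeries.mk sigmaOne * PowerSeries.mk colored) := by
    have : PowerSeries.mk colored = partitionSeries ^ 24 := by
      ext n; simp [colored]
    rw [this, PowerSeries.derivative_pow]
    linear_combination (24 * partitionSeries ^ 23) * hf
  have h := congrArg (PowerSeries.coeff N) hF
  rw [hD] at h
  have h24 : (24 : PowerSeries ℤ) = PowerSeries.C (24 : ℤ) := by simp
  rw [h24, PowerSeries.coeff_C_mul, to_icc _ _ (by simp [sigmaOne])] at h
  exact h

theorem colored_nonneg_and_mono (N : ℕ) : 0 ≤ colored N ∧ colored N ≤ colored (N + 1) := by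
  have h (k : ℕ) : (∀ N, 0 ≤ PowerSeries.coeff N (partitionSeries ^ (k + 1))) ∧
      ∀ N, PowerSeries.coeff N (partitionSeries ^ (k + 1)) ≤
        PowerSeries.coeff (N + 1) (partitionSeries ^ (k + 1)) := by
    induction k with
    | zero => simpa [partitionSeries] using card_partition_mono
    | succ k ih =>
      constructor
      · intro N
        rw [pow_succ, PowerSeries.coeff_mul]
        exact Finset.sum_nonneg fun x _ => mul_nonneg (ih.1 _) (by simp [partitionSeries])
      · intro N
        rw [pow_succ, PowerSeries.coeff_mul, PowerSeries.coeff_mul,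
          Finset.Nat.sum_antidiagonal_succ]
        refine (Finset.sum_le_sum fun x _ => mul_le_mul_of_nonneg_right (ih.2 x.1)
          (by simp [partitionSeries])).trans ?_
        exact le_add_of_nonneg_left (mul_nonneg (ih.1 _) (by simp [partitionSeries]))
  exact ⟨(h 23).1 N, (h 23).2 N⟩

theorem colored_monotone : Monotone colored :=
  monotone_nat_of_le_succ fun N => (colored_nonneg_and_mono N).2

theorem colored_zero : colored 0 = 1 := by
  simp [colored, partitionSeries]

theorem colored_one : colored 1 = 24 := by
  have h := colored_recurrence 1
  simpa [sigmaOne, colored_zero] using h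

theorem colored_two : colored 2 = 324 := by
  have h := colored_recurrence 2
  rw [Finset.sum_Icc_succ_top (by norm_num)] at h
  have h2 : sigmaOne 2 = 3 := by decide
  have h1 : sigmaOne 1 = 1 := by decide
  simp [h1, h2, colored_zero, colored_one] at h
  linarith

theorem colored_three : colored 3 = 3200 := by
  have h := colored_recurrence 3
  rw [Finset.sum_Icc_succ_top (by norm_num), Finset.sum_Icc_succ_top (by norm_num)] at h
  have h3 : sigmaOne 3 = 4 := by decide
  have h2 : sigmaOne 2 = 3 := by decide
  have h1 : sigmaOne 1 = 1 := by decide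
  simp [h1, h2, h3, colored_zero, colored_one, colored_two] at h
  linarith

theorem le_sigmaOne {k : ℕ} (hk : 1 ≤ k) : (k : ℤ) ≤ sigmaOne k :=
  Finset.single_le_sum (f := fun i : ℕ => (i : ℤ)) (fun i _ => by positivity)
    (Nat.mem_divisors_self k (by omega))

theorem two_mul_sigmaOne_le (k : ℕ) : 2 * sigmaOne k ≤ k * (k + 1) := by
  have hsub : k.divisors ⊆ Finset.range (k + 1) := fun i hi =>
    Finset.mem_range.2 (Nat.lt_succ_of_le (Nat.divisor_le hi))
  have h1 : sigmaOne k ≤ ∑ i ∈ Finset.range (k + 1), (i : ℤ) :=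
    Finset.sum_le_sum_of_subset_of_nonneg hsub fun _ _ _ => by positivity
  have h2 : (∑ i ∈ Finset.range (k + 1), (i : ℤ)) * 2 = (k + 1) * k := by
    have := Finset.sum_range_id_mul_two (k + 1)
    rw [Nat.add_sub_cancel] at this
    have := congrArg (Nat.cast : ℕ → ℤ) this
    push_cast at this
    exact this
  linarith

/-- A linear lower bound for the coloured partition numbers improves to a quadratic one. -/
theorem quadratic_le_colored {N : ℕ} (hN : 1 ≤ N)
    (h : ∀ i < N, 160 * (i : ℤ) - 136 ≤ colored i) :
    ((N : ℤ) + 1) * (640 * N - 2272) ≤ colored N := by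
  have hsum (n : ℕ) : 24 * ∑ k ∈ Finset.Icc 1 n, (k : ℤ) * (160 * ((N : ℤ) - k) - 136) =
      n * (n + 1) * (1920 * N - 1632) - 640 * n * (n + 1) * (2 * n + 1) := by
    induction n with
    | zero => simp
    | succ n ih =>
      rw [Finset.sum_Icc_succ_top (by omega), mul_add, ih]
      push_cast
      ring
  have hle : ∑ k ∈ Finset.Icc 1 N, (k : ℤ) * (160 * ((N : ℤ) - k) - 136) ≤
      ∑ k ∈ Finset.Icc 1 N, sigmaOne k * colored (N - k) := by
    refine Finset.sum_le_sum fun k hk => ?_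
    rw [Finset.mem_Icc] at hk
    have h1 := h (N - k) (by omega)
    rw [Nat.cast_sub hk.2] at h1
    exact (mul_le_mul_of_nonneg_left h1 (by positivity)).trans
      (mul_le_mul_of_nonneg_right (le_sigmaOne hk.1) (colored_nonneg_and_mono _).1)
  have hN' : (0 : ℤ) < N := by exact_mod_cast hN
  have hrec := colored_recurrence N
  have := hsum N
  refine le_of_mul_le_mul_left ?_ hN'
  nlinarith

theorem linear_le_colored (N : ℕ) : 160 * (N : ℤ) - 136 ≤ colored N := by
  induction N using Nat.strong_induction_on with
  | _ N ih =>
  rcases lt_or_ge N 4 with hN | hN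
  · interval_cases N <;> simp [colored_zero, colored_one, colored_two, colored_three]
  · have h := quadratic_le_colored (by omega) ih
    have : (4 : ℤ) ≤ N := by exact_mod_cast hN
    nlinarith

theorem le_colored {N : ℕ} (hN : 3 ≤ N) : 600 * ((N : ℤ) + 1) ≤ colored N := by
  rcases lt_or_ge N 5 with h5 | h5
  · have := colored_monotone hN
    rw [colored_three] at this
    have : (N : ℤ) ≤ 4 := by exact_mod_cast (by omega : N ≤ 4)
    linarith
  · have h := quadratic_le_colored (by omega : 1 ≤ N) fun i _ => linear_le_colored i
    have : (5 : ℤ) ≤ N := by exact_mod_cast h5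
    nlinarith

theorem quadratic_le_colored_of_two_le {N : ℕ} (hN : 2 ≤ N) :
    12 * (N : ℤ) * (11 * N - 9) ≤ colored N := by
  rcases lt_or_ge N 5 with h5 | h5
  · have h3 : 3 ≤ N → (3200 : ℤ) ≤ colored N := fun h => by
      simpa [colored_three] using colored_monotone h
    interval_cases N
    · simp [colored_two]
    · exact le_trans (by norm_num) (h3 le_rfl)
    · exact le_trans (by norm_num) (h3 (by norm_num))
  · have h := quadratic_le_colored (by omega : 1 ≤ N) fun i _ => linear_le_colored i
    have : (5 : ℤ) ≤ N := by exact_mod_cast h5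
    nlinarith

theorem colored_succ_le {N : ℕ} (hN : 1 ≤ N) : colored (N + 1) ≤ 14 * colored N := by
  induction N using Nat.strong_induction_on with
  | _ N ih =>
  obtain rfl | h2 : N = 1 ∨ 2 ≤ N := by omega
  · simp [colored_one, colored_two]
  obtain ⟨M, rfl⟩ : ∃ M, N = M + 1 := ⟨N - 1, by omega⟩
  have hr1 := colored_recurrence (M + 1 + 1)
  have hr0 := colored_recurrence (M + 1)
  rw [Finset.sum_Icc_succ_top (by omega), Finset.sum_Icc_succ_top (by omega)] at hr1
  rw [Finset.sum_Icc_succ_top (by omega)] at hr0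
  have hstep : ∑ k ∈ Finset.Icc 1 M, sigmaOne k * colored (M + 1 + 1 - k) ≤
      14 * ∑ k ∈ Finset.Icc 1 M, sigmaOne k * colored (M + 1 - k) := by
    rw [Finset.mul_sum]
    refine Finset.sum_le_sum fun k hk => ?_
    rw [Finset.mem_Icc] at hk
    have h := ih (M + 1 - k) (by omega) (by omega)
    rw [show M + 1 + 1 - k = M + 1 - k + 1 by omega]
    have := mul_le_mul_of_nonneg_left h ((Int.natCast_nonneg k).trans (le_sigmaOne hk.1))
    linarith
  simp only [Nat.sub_self, Nat.add_sub_cancel_left, colored_zero, colored_one] at hr1 hr0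
  have hs1 := two_mul_sigmaOne_le (M + 1)
  have hs2 := two_mul_sigmaOne_le (M + 1 + 1)
  have hq := quadratic_le_colored_of_two_le (by omega : 2 ≤ M + 1 + 1)
  push_cast at *
  have hpos : (0 : ℤ) < M + 1 := by positivity
  refine le_of_mul_le_mul_left ?_ hpos
  nlinarith

theorem dcoef_natCast (n : ℕ) : dcoef n = colored (n + 1) := by
  rw [dcoef_eq, if_pos (by omega)]
  rfl

theorem dcoef_of_lt {n : ℤ} (hn : n < -1) : dcoef n = 0 := by
  rw [dcoef_eq, if_neg (by omega)]

theorem dcoef_nonneg (n : ℤ) : 0 ≤ dcoef n := by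
  rw [dcoef_eq]
  split_ifs
  exacts [(colored_nonneg_and_mono _).1, le_rfl]

theorem dcoef_monotone : Monotone dcoef := by
  intro a b hab
  by_cases ha : 0 ≤ a + 1
  · rw [dcoef_eq, dcoef_eq, if_pos ha, if_pos (by omega)]
    exact colored_monotone (Int.toNat_le_toNat (by omega))
  · rw [dcoef_of_lt (by omega : a < -1)]
    exact dcoef_nonneg b

theorem dcoef_le_of_nonpos {n : ℤ} (hn : n ≤ 0) : dcoef n ≤ 24 := by
  have h : dcoef ((0 : ℕ) : ℤ) = 24 := by rw [dcoef_natCast, colored_one]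
  exact h ▸ dcoef_monotone (by simpa using hn)

theorem dcoef_pos {n : ℤ} (hn : 0 ≤ n) : 0 < dcoef n := by
  have h : dcoef ((0 : ℕ) : ℤ) = 24 := by rw [dcoef_natCast, colored_one]
  have := dcoef_monotone (by simpa using hn : ((0 : ℕ) : ℤ) ≤ n)
  omega

theorem dcoef_add_le {n : ℤ} (hn : 0 ≤ n) (j : ℕ) : dcoef (n + j) ≤ 14 ^ j * dcoef n := by
  lift n to ℕ using hn
  induction j with
  | zero => simp
  | succ j ih =>
    have h := colored_succ_le (N := n + j + 1) (by omega)
    rw [← Nat.cast_add, dcoef_natCast] at ih ⊢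
    rw [pow_succ, ← add_assoc n j 1]
    linarith

theorem le_dcoef {n : ℤ} (hn : 1 ≤ n) : 600 * (n + 3) ≤ dcoef (n + 1) := by
  lift n to ℕ using by omega
  have h := le_colored (N := n + 1 + 1) (by omega)
  have e : dcoef ((n : ℤ) + 1) = colored (n + 1 + 1) := by exact_mod_cast dcoef_natCast (n + 1)
  rw [e]
  push_cast at h
  linarith

/-- The summand of `polarCoef` as a function on quadruples `(p, q, r, s)`. -/
noncomputable def polarTerm (m N l : ℤ) (x : ℤ × ℤ × ℤ × ℤ) : ℤ :=
  if x.1 * x.2.2.2 - x.2.1 * x.2.2.1 = 1 ∧ 0 < x.2.2.1 ∧ 0 < x.2.2.2 ∧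
      0 ≤ (l : ℚ) / (2 * m) - (x.2.1 : ℚ) / x.2.2.2 ∧
      (l : ℚ) / (2 * m) - (x.2.1 : ℚ) / x.2.2.2 < 1 / ((x.2.2.1 : ℚ) * x.2.2.2) then
    (-2 * x.2.2.1 * x.2.2.2 * N - 2 * x.1 * x.2.1 * m +
        (x.1 * x.2.2.2 + x.2.1 * x.2.2.1) * l) *
      dcoef (x.2.2.1 ^ 2 * N + x.1 ^ 2 * m - x.1 * x.2.2.1 * l) *
      dcoef (x.2.2.2 ^ 2 * N + x.2.1 ^ 2 * m - x.2.1 * x.2.2.2 * l)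
  else 0

theorem polarCoef_eq_finsum {m N l : ℤ} (h : (Function.support (polarTerm m N l)).Finite) :
    polarCoef m N l = ∑ᶠ x, polarTerm m N l x := by
  rw [finsum_curry _ h]
  refine finsum_congr fun p => ?_
  have hp : (Function.support fun y => polarTerm m N l (p, y)).Finite :=
    h.preimage (Prod.mk_right_injective p).injOn
  rw [finsum_curry _ hp]
  refine finsum_congr fun q => ?_
  have hq : (Function.support fun y => polarTerm m N l (p, q, y)).Finite :=
    hp.preimage (Prod.mk_right_injective q).injOn
  rw [finsum_curry _ hq]
  rfl

/-- The unimodular pairs `q / s ≤ l / (2m) < p / r`. -/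
def IsFareyPair (m l : ℤ) (x : ℤ × ℤ × ℤ × ℤ) : Prop :=
  x.1 * x.2.2.2 - x.2.1 * x.2.2.1 = 1 ∧ 0 < x.2.2.1 ∧ 0 < x.2.2.2 ∧
    2 * m * x.2.1 ≤ l * x.2.2.2 ∧ l * x.2.2.1 < 2 * m * x.1

/-- The value of the quadratic form `N x² - l x y + m y²` at the right endpoint `(r, p)`. -/
def rightValue (m N l : ℤ) (x : ℤ × ℤ × ℤ × ℤ) : ℤ :=
  x.2.2.1 ^ 2 * N + x.1 ^ 2 * m - x.1 * x.2.2.1 * l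

/-- The value of the quadratic form `N x² - l x y + m y²` at the left endpoint `(s, q)`. -/
def leftValue (m N l : ℤ) (x : ℤ × ℤ × ℤ × ℤ) : ℤ :=
  x.2.2.2 ^ 2 * N + x.2.1 ^ 2 * m - x.2.1 * x.2.2.2 * l

/-- Minus the polar form of the quadratic form at the two endpoints. -/
def crossValue (m N l : ℤ) (x : ℤ × ℤ × ℤ × ℤ) : ℤ :=
  -2 * x.2.2.1 * x.2.2.2 * N - 2 * x.1 * x.2.1 * m + (x.1 * x.2.2.2 + x.2.1 * x.2.2.1) * l

theorem polarTerm_of_not {m N l : ℤ} (hm : 0 < m) {x : ℤ × ℤ × ℤ × ℤ}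
    (hx : ¬ IsFareyPair m l x) : polarTerm m N l x = 0 := by
  obtain ⟨p, q, r, s⟩ := x
  refine if_neg fun ⟨h1, h2, h3, h4, h5⟩ => hx ⟨h1, h2, h3, ?_, ?_⟩
  all_goals simp only at h1 h2 h3 h4 h5 ⊢
  · have hm' : (0 : ℚ) < m := by exact_mod_cast hm
    have hs' : (0 : ℚ) < s := by exact_mod_cast h3
    rw [sub_nonneg, div_le_div_iff₀ hs' (by positivity)] at h4
    have : q * (2 * m) ≤ l * s := by exact_mod_cast h4
    linarith
  · have hm' : (0 : ℚ) < m := by exact_mod_cast hm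
    have hs' : (0 : ℚ) < s := by exact_mod_cast h3
    have hr' : (0 : ℚ) < r := by exact_mod_cast h2
    have hdet : (p : ℚ) * s - q * r = 1 := by exact_mod_cast h1
    have e : (q : ℚ) / s + 1 / (r * s) = p / r := by
      field_simp
      linarith
    rw [sub_lt_iff_lt_add', e, div_lt_div_iff₀ (by positivity) hr'] at h5
    have : l * r < p * (2 * m) := by exact_mod_cast h5
    linarith

theorem polarTerm_of_isFareyPair {m N l : ℤ} (hm : 0 < m) {x : ℤ × ℤ × ℤ × ℤ}
    (hx : IsFareyPair m l x) : polarTerm m N l x =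
      crossValue m N l x * dcoef (rightValue m N l x) * dcoef (leftValue m N l x) := by
  obtain ⟨p, q, r, s⟩ := x
  obtain ⟨h1, h2, h3, h4, h5⟩ := hx
  refine if_pos ⟨h1, h2, h3, ?_, ?_⟩
  all_goals
    simp only at h1 h2 h3 h4 h5 ⊢
    have hm' : (0 : ℚ) < m := by exact_mod_cast hm
    have hs' : (0 : ℚ) < s := by exact_mod_cast h3
    have hr' : (0 : ℚ) < r := by exact_mod_cast h2
  · rw [sub_nonneg, div_le_div_iff₀ hs' (by positivity)]
    exact_mod_cast (by linarith : q * (2 * m) ≤ l * s)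
  · have hdet : (p : ℚ) * s - q * r = 1 := by exact_mod_cast h1
    have e : (q : ℚ) / s + 1 / (r * s) = p / r := by
      field_simp
      linarith
    rw [sub_lt_iff_lt_add', e, div_lt_div_iff₀ (by positivity) hr']
    exact_mod_cast (by linarith : l * r < p * (2 * m))

theorem crossValue_pos {m N l : ℤ} (hm : 0 < m) (hD : 0 < l ^ 2 - 4 * m * N)
    {x : ℤ × ℤ × ℤ × ℤ} (hx : IsFareyPair m l x) : 0 < crossValue m N l x := by
  obtain ⟨p, q, r, s⟩ := x
  obtain ⟨h1, h2, h3, h4, h5⟩ := hx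
  simp only [crossValue] at *
  have h6 := mul_nonneg (sub_nonneg.2 h5.le) (sub_nonneg.2 h4)
  have h7 := mul_pos (mul_pos h2 h3) hD
  refine pos_of_mul_pos_right (a := 2 * m) ?_ (by positivity)
  linarith

theorem crossValue_sq {m N l : ℤ} {x : ℤ × ℤ × ℤ × ℤ} (hx : IsFareyPair m l x) :
    crossValue m N l x ^ 2 =
      l ^ 2 - 4 * m * N + 4 * rightValue m N l x * leftValue m N l x := by
  obtain ⟨p, q, r, s⟩ := x
  have h1 := hx.1
  simp only [crossValue, rightValue, leftValue] at *
  linear_combination (l ^ 2 - 4 * m * N) * (p * s - q * r + 1) * h1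

theorem polarTerm_nonneg {m N l : ℤ} (hm : 0 < m) (hD : 0 < l ^ 2 - 4 * m * N)
    (x : ℤ × ℤ × ℤ × ℤ) : 0 ≤ polarTerm m N l x := by
  by_cases hx : IsFareyPair m l x
  · rw [polarTerm_of_isFareyPair hm hx]
    exact mul_nonneg (mul_nonneg (crossValue_pos hm hD hx).le (dcoef_nonneg _)) (dcoef_nonneg _)
  · rw [polarTerm_of_not hm hx]

/-- One step of the Stern–Brocot descent towards `l / (2m)`. -/
def fareyStep (m l : ℤ) (x : ℤ × ℤ × ℤ × ℤ) : ℤ × ℤ × ℤ × ℤ :=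
  if l * (x.2.2.1 + x.2.2.2) < 2 * m * (x.1 + x.2.1) then
    (x.1 + x.2.1, x.2.1, x.2.2.1 + x.2.2.2, x.2.2.2)
  else (x.1, x.1 + x.2.1, x.2.2.1, x.2.2.1 + x.2.2.2)

/-- Farey pairs at which both values of the quadratic form are at least `-1`. -/
def IsGoodPair (m N l : ℤ) (x : ℤ × ℤ × ℤ × ℤ) : Prop :=
  IsFareyPair m l x ∧ -1 ≤ rightValue m N l x ∧ -1 ≤ leftValue m N l x

theorem polarTerm_of_not_good {m N l : ℤ} (hm : 0 < m) {x : ℤ × ℤ × ℤ × ℤ}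
    (hx : ¬ IsGoodPair m N l x) : polarTerm m N l x = 0 := by
  by_cases h : IsFareyPair m l x
  · rw [polarTerm_of_isFareyPair hm h]
    by_cases hr : -1 ≤ rightValue m N l x
    · rw [dcoef_of_lt (n := leftValue m N l x), mul_zero]
      by_contra hl
      exact hx ⟨h, hr, by omega⟩
    · rw [dcoef_of_lt (n := rightValue m N l x) (by omega), mul_zero, zero_mul]
  · exact polarTerm_of_not hm h

theorem eq_of_isFareyPair_of_eq {m l : ℤ} (hl0 : 0 ≤ l) (hl : l ≤ m) (hm : 0 < m)
    {x : ℤ × ℤ × ℤ × ℤ} (hx : IsFareyPair m l x) (hrs : x.2.2.1 = x.2.2.2) :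
    x = (1, 0, 1, 1) := by
  obtain ⟨p, q, r, s⟩ := x
  obtain ⟨h1, h2, h3, h4, h5⟩ := hx
  simp only at *
  subst hrs
  have hr : r = 1 := by
    have : r ∣ 1 := ⟨p - q, by linarith⟩
    exact Int.eq_one_of_dvd_one h2.le this
  subst hr
  have hp : 0 < p := by
    by_contra h
    nlinarith
  have hq : q < 1 := by
    by_contra h
    nlinarith
  obtain rfl : p = 1 := by omega
  obtain rfl : q = 0 := by omega
  rfl

/-- A good pair other than the initial one comes from a good pair by a descent step, under which
the two values decrease. -/
theorem exists_parent {m N l : ℤ} (hl0 : 0 ≤ l) (hl : l ≤ m) (hm : 0 < m)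
    (hD : 0 < l ^ 2 - 4 * m * N) {x : ℤ × ℤ × ℤ × ℤ} (hx : IsGoodPair m N l x)
    (hne : x ≠ (1, 0, 1, 1)) :
    ∃ y, IsGoodPair m N l y ∧ fareyStep m l y = x ∧
      y.2.2.1 + y.2.2.2 < x.2.2.1 + x.2.2.2 ∧
      rightValue m N l x ≤ rightValue m N l y ∧ leftValue m N l x ≤ leftValue m N l y ∧
      rightValue m N l x + leftValue m N l x + 1 ≤ rightValue m N l y + leftValue m N l y := by
  have hL := crossValue_pos hm hD hx.1
  have hneq : x.2.2.1 ≠ x.2.2.2 := fun h => hne (eq_of_isFareyPair_of_eq hl0 hl hm hx.1 h)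
  obtain ⟨p, q, r, s⟩ := x
  obtain ⟨⟨h1, h2, h3, h4, h5⟩, hA, hB⟩ := hx
  rcases lt_or_gt_of_ne hneq with hrs | hrs
  · have hF : IsFareyPair m l (p, q - p, r, s - r) := by
      simp only [IsFareyPair] at *
      exact ⟨by linarith, h2, by linarith, by linarith, h5⟩
    have hL' := crossValue_pos hm hD hF
    have eL : crossValue m N l (p, q - p, r, s - r) =
        crossValue m N l (p, q, r, s) + 2 * rightValue m N l (p, q, r, s) := by
      simp only [crossValue, rightValue]; ring
    have eB : leftValue m N l (p, q - p, r, s - r) = rightValue m N l (p, q, r, s) +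
        leftValue m N l (p, q, r, s) + crossValue m N l (p, q, r, s) := by
      simp only [crossValue, rightValue, leftValue]; ring
    have eA : rightValue m N l (p, q - p, r, s - r) = rightValue m N l (p, q, r, s) := rfl
    refine ⟨(p, q - p, r, s - r), ⟨hF, by omega, by omega⟩, ?_, ?_, by omega, by omega, by omega⟩
    · simp only [fareyStep] at *
      rw [if_neg (by ring_nf at h4 ⊢; linarith)]
      simp
    · simp only at *
      omega
  · have hF : IsFareyPair m l (p - q, q, r - s, s) := by
      simp only [IsFareyPair] at *
      exact ⟨by linarith, by linarith, h3, h4, by linarith⟩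
    have hL' := crossValue_pos hm hD hF
    have eL : crossValue m N l (p - q, q, r - s, s) =
        crossValue m N l (p, q, r, s) + 2 * leftValue m N l (p, q, r, s) := by
      simp only [crossValue, leftValue]; ring
    have eA : rightValue m N l (p - q, q, r - s, s) = rightValue m N l (p, q, r, s) +
        leftValue m N l (p, q, r, s) + crossValue m N l (p, q, r, s) := by
      simp only [crossValue, rightValue, leftValue]; ring
    have eB : leftValue m N l (p - q, q, r - s, s) = leftValue m N l (p, q, r, s) := rfl
    refine ⟨(p - q, q, r - s, s), ⟨hF, by omega, by omega⟩, ?_, ?_, by omega, by omega, by omega⟩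
    · simp only [fareyStep] at *
      rw [if_pos (by ring_nf at h5 ⊢; linarith)]
      simp
    · simp only at *
      omega

theorem exists_iterate_of_isGoodPair {m N l : ℤ} (hl0 : 0 ≤ l) (hl : l ≤ m) (hm : 0 < m)
    (hD : 0 < l ^ 2 - 4 * m * N) (x : ℤ × ℤ × ℤ × ℤ) (hx : IsGoodPair m N l x) :
    ∃ k : ℕ, (fareyStep m l)^[k] (1, 0, 1, 1) = x ∧
      k + rightValue m N l x + leftValue m N l x ≤
        rightValue m N l (1, 0, 1, 1) + leftValue m N l (1, 0, 1, 1) := by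
  induction hn : (x.2.2.1 + x.2.2.2).toNat using Nat.strong_induction_on generalizing x with
  | _ n ih =>
  by_cases hne : x = (1, 0, 1, 1)
  · exact ⟨0, by simp [hne]⟩
  · obtain ⟨y, hy, hstep, hlt, -, -, hsum⟩ := exists_parent hl0 hl hm hD hx hne
    have := hy.1.2.1
    have := hy.1.2.2.1
    obtain ⟨k, hk, hk'⟩ := ih _ (by omega) y hy rfl
    refine ⟨k + 1, by rw [Function.iterate_succ_apply', hk, hstep], ?_⟩
    push_cast
    omega

/-- For `l < m` every further pair lies below `(1, 0, 2, 1)`. -/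
theorem exists_iterate_of_isGoodPair_of_ne {m N l : ℤ} (hl0 : 0 ≤ l) (hl : l < m)
    (hD : 0 < l ^ 2 - 4 * m * N) (x : ℤ × ℤ × ℤ × ℤ) (hx : IsGoodPair m N l x)
    (hne : x ≠ (1, 0, 1, 1)) :
    rightValue m N l x ≤ 4 * N + m - 2 * l ∧ leftValue m N l x ≤ N ∧
    ∃ k : ℕ, (fareyStep m l)^[k] (1, 0, 2, 1) = x ∧
      k + rightValue m N l x + leftValue m N l x ≤ 5 * N + m - 2 * l := by
  have hm : 0 < m := by omega
  induction hn : (x.2.2.1 + x.2.2.2).toNat using Nat.strong_induction_on generalizing x with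
  | _ n ih =>
  obtain ⟨y, hy, hstep, hlt, hA, hB, hsum⟩ := exists_parent hl0 hl.le hm hD hx hne
  by_cases hroot : y = (1, 0, 1, 1)
  · have hx' : x = (1, 0, 2, 1) := by
      rw [← hstep, hroot]
      exact if_pos (by simp; linarith)
    subst hx'
    simp only [rightValue, leftValue]
    refine ⟨by linarith, by linarith, 0, rfl, ?_⟩
    push_cast
    linarith
  · have := hy.1.2.1
    have := hy.1.2.2.1
    obtain ⟨hA', hB', k, hk, hk'⟩ := ih _ (by omega) y hy hroot rfl
    refine ⟨by omega, by omega, k + 1, by rw [Function.iterate_succ_apply', hk, hstep], ?_⟩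
    push_cast
    omega

theorem finite_support_polarTerm {m N l : ℤ} (hl0 : 0 ≤ l) (hl : l ≤ m) (hm : 0 < m)
    (hD : 0 < l ^ 2 - 4 * m * N) : (Function.support (polarTerm m N l)).Finite := by
  refine ((Set.finite_Iio (2 * N + m - l + 3).toNat).image
    fun k => (fareyStep m l)^[k] (1, 0, 1, 1)).subset fun x hx => ?_
  have hg : IsGoodPair m N l x := by
    by_contra h
    exact hx (polarTerm_of_not_good hm h)
  obtain ⟨k, hk, hk'⟩ := exists_iterate_of_isGoodPair hl0 hl hm hD x hg
  refine ⟨k, ?_, hk⟩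
  have := hg.2
  simp only [rightValue, leftValue] at hk' this
  simp only [Set.mem_Iio]
  omega

theorem isFareyPair_root {m l : ℤ} (hl0 : 0 ≤ l) (hl : l ≤ m) (hm : 0 < m) :
    IsFareyPair m l (1, 0, 1, 1) := by
  simp only [IsFareyPair]
  omega

theorem polarTerm_root {m N l : ℤ} (hl0 : 0 ≤ l) (hl : l ≤ m) (hm : 0 < m) :
    polarTerm m N l (1, 0, 1, 1) = (l - 2 * N) * dcoef (N + m - l) * dcoef N := by
  rw [polarTerm_of_isFareyPair hm (isFareyPair_root hl0 hl hm)]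
  simp only [crossValue, rightValue, leftValue]
  ring_nf

theorem le_polarCoef {m N : ℤ} (hm : 0 < m) (hN : 4 * m * N < m ^ 2) :
    (m - 2 * N) * dcoef N ^ 2 ≤ polarCoef m N m := by
  have hfin := finite_support_polarTerm hm.le le_rfl hm (N := N) (by linarith)
  have h := single_le_finsum (1, 0, 1, 1) hfin (polarTerm_nonneg hm (by linarith))
  rw [← polarCoef_eq_finsum hfin, polarTerm_root hm.le le_rfl hm] at h
  refine le_trans (le_of_eq ?_) h
  rw [add_sub_cancel_right]
  ring

theorem polarCoef_le {m N l : ℤ} (hl0 : 0 ≤ l) (hl : l < m) (hN : 1 ≤ N)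
    (hD : 0 < l ^ 2 - 4 * m * N) :
    polarCoef m N l ≤ (l - 2 * N) * dcoef N *
      (dcoef (N + m - l) + (5 * N + m - 2 * l + 3).toNat * dcoef (4 * N + m - 2 * l)) := by
  classical
  have hm : 0 < m := by omega
  have hfin := finite_support_polarTerm hl0 hl.le hm hD
  have hlN : 4 * N < l := by nlinarith
  set T := hfin.toFinset.erase (1, 0, 1, 1) with hT
  have hgood : ∀ x ∈ T, IsGoodPair m N l x ∧ x ≠ (1, 0, 1, 1) := fun x hx => by
    rw [hT, Finset.mem_erase, Set.Finite.mem_toFinset] at hx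
    refine ⟨?_, hx.1⟩
    by_contra h
    exact hx.2 (polarTerm_of_not_good hm h)
  have hcard : T.card ≤ (5 * N + m - 2 * l + 3).toNat := by
    have hsub : T ⊆ (Finset.range (5 * N + m - 2 * l + 3).toNat).image
        fun k => (fareyStep m l)^[k] (1, 0, 2, 1) := fun x hx => by
      obtain ⟨hg, hne⟩ := hgood x hx
      obtain ⟨-, -, k, hk, hk'⟩ := exists_iterate_of_isGoodPair_of_ne hl0 hl hD x hg hne
      have := hg.2
      exact Finset.mem_image.2 ⟨k, Finset.mem_range.2 (by omega), hk⟩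
    exact (Finset.card_le_card hsub).trans (Finset.card_image_le.trans (by simp))
  have hterm : ∀ x ∈ T, polarTerm m N l x ≤
      (l - 2 * N) * dcoef (4 * N + m - 2 * l) * dcoef N := fun x hx => by
    obtain ⟨hg, hne⟩ := hgood x hx
    obtain ⟨hA, hB, -⟩ := exists_iterate_of_isGoodPair_of_ne hl0 hl hD x hg hne
    rw [polarTerm_of_isFareyPair hm hg.1]
    have hcross : crossValue m N l x ≤ l - 2 * N := by
      have hsq := crossValue_sq (N := N) hg.1
      obtain ⟨-, h1, h2⟩ := hg
      have hprod : rightValue m N l x * leftValue m N l x ≤ (N + m - l) * N := by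
        rcases le_or_gt 0 (rightValue m N l x) with h0 | h0
        · exact (mul_le_mul_of_nonneg_left hB h0).trans
            (mul_le_mul_of_nonneg_right (by linarith) (by linarith))
        · rw [show rightValue m N l x = -1 by omega]
          nlinarith
      refine abs_le_of_sq_le_sq' ?_ (by linarith) |>.2
      linarith
    have h3 := dcoef_monotone hA
    have h4 := dcoef_monotone hB
    have := dcoef_nonneg (rightValue m N l x)
    have := dcoef_nonneg (leftValue m N l x)
    have := dcoef_nonneg (4 * N + m - 2 * l)
    have : 0 ≤ l - 2 * N := by linarith
    gcongr
  have hsum : polarCoef m N l ≤ polarTerm m N l (1, 0, 1, 1) + ∑ x ∈ T, polarTerm m N l x := by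
    rw [polarCoef_eq_finsum hfin, finsum_eq_sum _ hfin, hT]
    by_cases hr : ((1, 0, 1, 1) : ℤ × ℤ × ℤ × ℤ) ∈ hfin.toFinset
    · rw [Finset.add_sum_erase _ _ hr]
    · rw [Finset.erase_eq_of_notMem hr]
      exact le_add_of_nonneg_left (polarTerm_nonneg hm hD _)
  have hb : 0 ≤ (l - 2 * N) * dcoef (4 * N + m - 2 * l) * dcoef N :=
    mul_nonneg (mul_nonneg (by linarith) (dcoef_nonneg _)) (dcoef_nonneg _)
  have h1 := Finset.sum_le_card_nsmul T _ _ hterm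
  have h2 : (T.card : ℤ) ≤ ((5 * N + m - 2 * l + 3).toNat : ℕ) := by exact_mod_cast hcard
  have h3 := mul_le_mul_of_nonneg_right h2 hb
  rw [polarTerm_root hl0 hl.le hm] at hsum
  rw [nsmul_eq_mul] at h1
  linarith

theorem quadratic_le_three_pow (j : ℕ) :
    ((j : ℤ) + 3) ^ 2 + 4 * (j + 3) + 12 ≤ 4 * 3 ^ (j + 2) := by
  induction j with
  | zero => norm_num
  | succ j ih =>
    rw [show j + 1 + 2 = j + 2 + 1 from rfl, pow_succ (3 : ℤ)]
    push_cast
    nlinarith [Int.natCast_nonneg j]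

/-- The non-extremal polar coefficients compared with the leading term of the extremal one. -/
theorem polarCoef_sub_le {m N : ℤ} {j : ℕ} (hm : 6 ≤ m) (hN : 1 ≤ N) (hj : 1 ≤ j)
    (hjm : (j : ℤ) ≤ m) (hD : 0 < (m - j) ^ 2 - 4 * m * N) :
    25 * polarCoef m N (m - j) ≤ 26 * 3 ^ (j - 1) * 14 ^ j * ((m - 2 * N) * dcoef N ^ 2) := by
  have hj' : (1 : ℤ) ≤ j := by exact_mod_cast hj
  have h := polarCoef_le (by linarith : (0 : ℤ) ≤ m - j) (by linarith) hN hD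
  rw [show N + m - (m - j) = N + j by ring] at h
  set C := 4 * N + m - 2 * (m - j) with hC
  rw [show 5 * N + m - 2 * (m - j) + 3 = C + N + 3 by rw [hC]; ring] at h
  have hlN : 4 * N < m - j := by nlinarith
  have hCm : C * m < j ^ 2 := by rw [hC]; nlinarith
  have hd := dcoef_add_le (by linarith : (0 : ℤ) ≤ N) j
  have hd0 := dcoef_nonneg (N + j)
  have hrest : 25 * (dcoef (N + j) + (C + N + 3).toNat * dcoef C) ≤
      26 * 3 ^ (j - 1) * dcoef (N + j) := by
    have h3 : (1 : ℤ) ≤ 3 ^ (j - 1) := one_le_pow₀ (by norm_num)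
    rcases le_or_gt C 0 with hC0 | hC0
    · have h1 := dcoef_le_of_nonpos hC0
      have h2 := le_dcoef hN
      have h4 := dcoef_monotone (by linarith : N + 1 ≤ N + j)
      have h5 : (((C + N + 3).toNat : ℕ) : ℤ) * dcoef C ≤ (N + 3) * 24 :=
        mul_le_mul (by omega) h1 (dcoef_nonneg _) (by linarith)
      nlinarith
    · have hCj : C < j := by nlinarith
      have hmj : m < j ^ 2 := by nlinarith
      obtain ⟨i, rfl⟩ : ∃ i, j = i + 3 := ⟨j - 3, by
        have : 3 ≤ j := by
          by_contra hlt
          have : j ≤ 2 := by omega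
          interval_cases j <;> norm_num at hmj <;> linarith
        omega⟩
      have h1 := dcoef_monotone (by linarith : C ≤ N + (i + 3 : ℕ))
      have hp := quadratic_le_three_pow i
      have h2 : (((C + N + 3).toNat : ℕ) : ℤ) + 1 ≤ 3 ^ (i + 2) := by
        push_cast at *
        have : ((C + N + 3).toNat : ℤ) = C + N + 3 := by omega
        rw [this]
        nlinarith
      have h5 : (((C + N + 3).toNat : ℕ) : ℤ) * dcoef C ≤
          (3 ^ (i + 2) - 1) * dcoef (N + (i + 3 : ℕ)) :=
        mul_le_mul (by linarith) h1 (dcoef_nonneg _) (by linarith)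
      rw [show i + 3 - 1 = i + 2 from rfl] at *
      nlinarith
  have hdN := dcoef_nonneg N
  have hfac : 0 ≤ (m - j - 2 * N) * dcoef N := mul_nonneg (by linarith) hdN
  calc 25 * polarCoef m N (m - j)
      ≤ (m - j - 2 * N) * dcoef N * (25 * (dcoef (N + j) + (C + N + 3).toNat * dcoef C)) := by
        linarith
    _ ≤ (m - 2 * N) * dcoef N * (26 * 3 ^ (j - 1) * (14 ^ j * dcoef N)) := by
        have : 0 ≤ 25 * (dcoef (N + j) + (C + N + 3).toNat * dcoef C) := by
          have := dcoef_nonneg C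
          positivity
        refine mul_le_mul ?_ (hrest.trans ?_) this (mul_nonneg (by linarith) hdN)
        · exact mul_le_mul_of_nonneg_right (by linarith) hdN
        · exact mul_le_mul_of_nonneg_left hd (by positivity)
    _ = _ := by ring

/-- The coefficients of the even power series of `x ^ (-22) * d/dx (x ^ (23 / 2) * I_{23/2}(x))`. -/
noncomputable def besselCoeff (k : ℕ) : ℝ :=
  2 / (2 ^ (2 * (k : ℝ) + 23 / 2) * (k.factorial : ℝ) * Real.Gamma ((k : ℝ) + 23 / 2))

theorem besselCoeff_pos (k : ℕ) : 0 < besselCoeff k := by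
  have := Real.Gamma_pos_of_pos (by positivity : (0 : ℝ) < (k : ℝ) + 23 / 2)
  unfold besselCoeff
  positivity

theorem besselCoeff_succ (k : ℕ) :
    besselCoeff (k + 1) * (4 * ((k : ℝ) + 1) * (k + 23 / 2)) = besselCoeff k := by
  have hG := Real.Gamma_pos_of_pos (by positivity : (0 : ℝ) < (k : ℝ) + 23 / 2)
  have h1 : Real.Gamma (((k + 1 : ℕ) : ℝ) + 23 / 2) =
      ((k : ℝ) + 23 / 2) * Real.Gamma ((k : ℝ) + 23 / 2) := by
    rw [← Real.Gamma_add_one (by positivity)]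
    congr 1
    push_cast
    ring
  have h2 : (2 : ℝ) ^ (2 * ((k + 1 : ℕ) : ℝ) + 23 / 2) = 2 ^ (2 * (k : ℝ) + 23 / 2) * 4 := by
    rw [show 2 * ((k + 1 : ℕ) : ℝ) + 23 / 2 = (2 * (k : ℝ) + 23 / 2) + (2 : ℕ) by push_cast; ring,
      Real.rpow_add (by norm_num), Real.rpow_natCast]
    norm_num
  rw [besselCoeff, besselCoeff, h1, h2, Nat.factorial_succ]
  have h3 : (0 : ℝ) < 2 ^ (2 * (k : ℝ) + 23 / 2) := by positivity
  have h4 : (0 : ℝ) < k.factorial := by positivity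
  push_cast
  field_simp

theorem summable_besselCoeff (x : ℝ) : Summable fun k => besselCoeff k * x ^ (2 * k + 22) := by
  have hle (k : ℕ) : besselCoeff k ≤ besselCoeff 0 / k.factorial := by
    induction k with
    | zero => simp
    | succ k ih =>
      have h1 := besselCoeff_succ k
      have h2 := besselCoeff_pos (k + 1)
      have h3 : (0 : ℝ) < k.factorial := by positivity
      rw [le_div_iff₀ h3] at ih
      rw [Nat.factorial_succ, le_div_iff₀ (by positivity)]
      push_cast
      refine le_trans ?_ ih
      rw [← h1]
      have h4 : (1 : ℝ) ≤ 4 * (k + 23 / 2) := by linarith [(Nat.cast_nonneg k : (0 : ℝ) ≤ k)]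
      have h5 : 0 ≤ besselCoeff (k + 1) * (((k : ℝ) + 1) * k.factorial) := by positivity
      nlinarith
  refine Summable.of_nonneg_of_le (fun k => ?_) (fun k => ?_)
    ((Real.summable_pow_div_factorial (x ^ 2)).mul_left (besselCoeff 0 * x ^ 22))
  · have := besselCoeff_pos k
    rw [show 2 * k + 22 = 2 * (k + 11) by ring, pow_mul]
    positivity
  · calc besselCoeff k * x ^ (2 * k + 22)
        ≤ besselCoeff 0 / k.factorial * x ^ (2 * k + 22) := by
          refine mul_le_mul_of_nonneg_right (hle k) ?_
          rw [show 2 * k + 22 = 2 * (k + 11) by ring, pow_mul]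
          positivity
      _ = _ := by rw [pow_add, pow_mul]; ring

/-- The function `x ^ (23 / 2) * I_{23/2}(x)` as a power series. -/
noncomputable def scaledBessel (x : ℝ) : ℝ :=
  ∑' k : ℕ, besselCoeff k / (2 * k + 23) * x ^ (2 * k + 23)

theorem summable_scaledBessel {x : ℝ} (hx : 0 ≤ x) :
    Summable fun k : ℕ => besselCoeff k / (2 * k + 23) * x ^ (2 * k + 23) := by
  refine Summable.of_nonneg_of_le (fun k => ?_) (fun k => ?_)
    ((summable_besselCoeff x).mul_right x)
  · have := besselCoeff_pos k
    positivity
  · have := besselCoeff_pos k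
    rw [mul_assoc, ← pow_succ]
    refine mul_le_mul_of_nonneg_right (div_le_self this.le ?_) (by positivity)
    linarith [(Nat.cast_nonneg k : (0 : ℝ) ≤ k)]

theorem scaledBessel_pos {x : ℝ} (hx : 0 < x) : 0 < scaledBessel x := by
  refine (summable_scaledBessel hx.le).tsum_pos (fun k => ?_) 0 ?_
  · have := besselCoeff_pos k
    positivity
  · have := besselCoeff_pos 0
    positivity

theorem rpow_mul_besselI {x : ℝ} (hx : 0 < x) :
    x ^ ((23 : ℝ) / 2) * besselI (23 / 2) x = scaledBessel x := by
  rw [besselI, scaledBessel, ← tsum_mul_left]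
  refine tsum_congr fun k => ?_
  have hG := Real.Gamma_pos_of_pos (by positivity : (0 : ℝ) < (k : ℝ) + 23 / 2)
  rw [Real.Gamma_add_one (by positivity), Real.div_rpow hx.le (by norm_num), besselCoeff]
  have h1 : x ^ (2 * k + 23) = x ^ ((23 : ℝ) / 2) * x ^ (2 * (k : ℝ) + 23 / 2) := by
    rw [← Real.rpow_add hx, ← Real.rpow_natCast]
    congr 1
    push_cast
    ring
  rw [h1]
  have h3 : (0 : ℝ) < 2 ^ (2 * (k : ℝ) + 23 / 2) := by positivity
  field_simp

theorem hasDerivAt_scaledBessel {x : ℝ} (hx : 0 < x) :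
    HasDerivAt scaledBessel (∑' k, besselCoeff k * x ^ (2 * k + 22)) x := by
  refine hasDerivAt_tsum_of_isPreconnected (t := Set.Ioo 0 (x + 1))
    (g := fun (k : ℕ) (y : ℝ) => besselCoeff k / (2 * k + 23) * y ^ (2 * k + 23))
    (g' := fun (k : ℕ) (y : ℝ) => besselCoeff k * y ^ (2 * k + 22))
    (summable_besselCoeff (x + 1)) isOpen_Ioo isPreconnected_Ioo (fun k y _ => ?_)
    (fun k y hy => ?_) (y₀ := x) ⟨hx, by linarith⟩ (summable_scaledBessel hx.le)
    ⟨hx, by linarith⟩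
  · refine ((hasDerivAt_pow (2 * k + 23) y).const_mul
      (besselCoeff k / (2 * k + 23))).congr_deriv ?_
    rw [show 2 * k + 23 - 1 = 2 * k + 22 from rfl]
    push_cast
    field_simp
  · have := besselCoeff_pos k
    have hy0 := hy.1
    rw [Real.norm_of_nonneg (by positivity)]
    exact mul_le_mul_of_nonneg_left (pow_le_pow_left₀ hy0.le hy.2.le _) this.le

theorem scaledBessel_le_deriv {x : ℝ} (hx : 0 < x) :
    scaledBessel x ≤ ∑' k, besselCoeff k * x ^ (2 * k + 22) := by
  have hs := summable_besselCoeff x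
  have hs1 := (summable_nat_add_iff 1).2 hs
  have hterm (k : ℕ) : besselCoeff k / (2 * k + 23) * x ^ (2 * k + 23) ≤
      (besselCoeff k * x ^ (2 * k + 22) + besselCoeff (k + 1) * x ^ (2 * (k + 1) + 22)) / 2 := by
    rw [← besselCoeff_succ k]
    have hb := besselCoeff_pos (k + 1)
    have e1 : besselCoeff (k + 1) * (4 * ((k : ℝ) + 1) * (k + 23 / 2)) / (2 * k + 23) *
        x ^ (2 * k + 23) = besselCoeff (k + 1) * x ^ (2 * k + 22) * (2 * (k + 1) * x) := by
      rw [pow_succ]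
      field_simp
      ring
    have e2 : (besselCoeff (k + 1) * (4 * ((k : ℝ) + 1) * (k + 23 / 2)) * x ^ (2 * k + 22) +
        besselCoeff (k + 1) * x ^ (2 * (k + 1) + 22)) / 2 =
        besselCoeff (k + 1) * x ^ (2 * k + 22) *
          ((4 * ((k : ℝ) + 1) * (k + 23 / 2) + x ^ 2) / 2) := by
      rw [show 2 * (k + 1) + 22 = 2 * k + 22 + 2 by ring, pow_add]
      ring
    rw [e1, e2]
    refine mul_le_mul_of_nonneg_left ?_ (by positivity)
    nlinarith [sq_nonneg (x - 2 * (k + 1)), (Nat.cast_nonneg k : (0 : ℝ) ≤ k)]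
  have h1 := (summable_scaledBessel hx.le).tsum_le_tsum hterm ((hs.add hs1).div_const 2)
  rw [tsum_div_const, hs.tsum_add hs1] at h1
  have h2 := hs.tsum_eq_zero_add
  have h3 : 0 ≤ besselCoeff 0 * x ^ (2 * 0 + 22) := by
    have := besselCoeff_pos 0
    positivity
  unfold scaledBessel
  linarith

theorem scaledBessel_le_exp_mul {x y : ℝ} (hx : 0 < x) (hxy : x ≤ y) :
    scaledBessel x ≤ Real.exp (-(y - x)) * scaledBessel y := by
  have hderiv : ∀ z ∈ Set.Ioi (0 : ℝ), HasDerivAt (fun z => Real.exp (-z) * scaledBessel z)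
      (Real.exp (-z) * (-1) * scaledBessel z +
        Real.exp (-z) * ∑' k, besselCoeff k * z ^ (2 * k + 22)) z := fun z hz =>
    ((hasDerivAt_neg z).exp).mul (hasDerivAt_scaledBessel hz)
  have hmono : MonotoneOn (fun z => Real.exp (-z) * scaledBessel z) (Set.Ioi 0) := by
    refine monotoneOn_of_deriv_nonneg (convex_Ioi 0)
      (fun z hz => (hderiv z hz).continuousAt.continuousWithinAt)
      (fun z hz => ?_) (fun z hz => ?_)
    · rw [interior_Ioi] at hz
      exact (hderiv z hz).differentiableAt.differentiableWithinAt
    · rw [interior_Ioi] at hz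
      rw [(hderiv z hz).deriv]
      have := mul_le_mul_of_nonneg_left (scaledBessel_le_deriv hz) (Real.exp_pos (-z)).le
      linarith
  have h := hmono hx (hx.trans_le hxy) hxy
  calc scaledBessel x = Real.exp x * (Real.exp (-x) * scaledBessel x) := by
        rw [← mul_assoc, ← Real.exp_add]; simp
    _ ≤ Real.exp x * (Real.exp (-y) * scaledBessel y) :=
        mul_le_mul_of_nonneg_left h (Real.exp_pos x).le
    _ = _ := by
        rw [← mul_assoc, ← Real.exp_add]
        congr 2
        ring

/-- The Bessel weight `D ^ (23/4) * I_{23/2}(c √D)`, normalised by `c`. -/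
theorem rpow_mul_besselI_sqrt {c D : ℝ} (hc : 0 < c) (hD : 0 < D) :
    D ^ ((23 : ℝ) / 4) * besselI (23 / 2) (c * √D) =
      (c ^ ((23 : ℝ) / 2))⁻¹ * scaledBessel (c * √D) := by
  have hs := Real.sqrt_pos.2 hD
  rw [← rpow_mul_besselI (mul_pos hc hs), Real.mul_rpow hc.le hs.le]
  have h : √D ^ ((23 : ℝ) / 2) = D ^ ((23 : ℝ) / 4) := by
    rw [Real.sqrt_eq_rpow, ← Real.rpow_mul hD.le]
    norm_num
  have hc' : 0 < c ^ ((23 : ℝ) / 2) := by positivity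
  rw [h]
  field_simp

theorem exp_five_three_ge : (196 : ℝ) ≤ Real.exp (53 / 10) := by
  have h1 := Real.exp_one_gt_d9
  have h2 : Real.exp (53 / 10) = Real.exp 1 ^ 5 * Real.exp (3 / 10) := by
    rw [← Real.exp_nat_mul, ← Real.exp_add]
    norm_num
  have h3 : (1.345 : ℝ) ≤ Real.exp (3 / 10) := by
    have := Real.quadratic_le_exp_of_nonneg (by norm_num : (0 : ℝ) ≤ 3 / 10)
    norm_num at this ⊢
    linarith
  have h4 : (2.718 : ℝ) ^ 5 ≤ Real.exp 1 ^ 5 := pow_le_pow_left₀ (by norm_num) (by linarith) 5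
  rw [h2]
  calc (196 : ℝ) ≤ 2.718 ^ 5 * 1.345 := by norm_num
    _ ≤ _ := by gcongr

theorem scaledBessel_sqrt_le {c m D₁ D₂ : ℝ} {j : ℕ} (hc : 53 / 10 ≤ c) (hm : (j : ℝ) ≤ m)
    (h1 : 0 < D₁) (hD1 : D₁ ≤ (m - j) ^ 2) (hD : D₂ - D₁ = m ^ 2 - (m - j) ^ 2) :
    scaledBessel (c * √D₁) ≤ (1 / 196) ^ j * scaledBessel (c * √D₂) := by
  have hj : (0 : ℝ) ≤ j := Nat.cast_nonneg j
  have hs : √D₁ ≤ m - j := Real.sqrt_le_iff.2 ⟨by linarith, hD1⟩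
  have hdiff : √D₁ + j ≤ √D₂ := by
    refine Real.le_sqrt_of_sq_le ?_
    have := Real.sq_sqrt h1.le
    nlinarith
  have hs1 := Real.sqrt_pos.2 h1
  have hc0 : 0 < c := by linarith
  refine (scaledBessel_le_exp_mul (mul_pos hc0 hs1)
    (mul_le_mul_of_nonneg_left (by linarith) hc0.le)).trans ?_
  refine mul_le_mul_of_nonneg_right ?_ (scaledBessel_pos (mul_pos hc0 (by linarith))).le
  calc Real.exp (-(c * √D₂ - c * √D₁)) ≤ Real.exp (-(j * (53 / 10))) := by
        refine Real.exp_le_exp.2 ?_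
        nlinarith
    _ = (1 / Real.exp (53 / 10)) ^ j := by
        rw [Real.exp_neg, Real.exp_nat_mul, one_div, inv_pow]
    _ ≤ (1 / 196) ^ j := by
        have := exp_five_three_ge
        gcongr

theorem le_pi_mul_sqrt_div {m Δ : ℝ} (hm : 0 < m) (hΔ : 3 * m ^ 2 ≤ Δ) :
    53 / 10 ≤ Real.pi * √Δ / m := by
  have h1 : 1.7 * m ≤ √Δ := Real.le_sqrt_of_sq_le (by nlinarith)
  have h2 := Real.pi_gt_d2
  rw [le_div_iff₀ hm]
  calc 53 / 10 * m ≤ 3.14 * (1.7 * m) := by nlinarith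
    _ ≤ _ := by gcongr

theorem sum_geometric_le (m : ℤ) :
    ∑ l ∈ Finset.Ico 0 m, (3 / 14 : ℝ) ^ (m - l).toNat ≤ 3 / 11 := by
  have h : ∑ l ∈ Finset.Ico 0 m, (3 / 14 : ℝ) ^ (m - l).toNat =
      ∑ i ∈ Finset.range m.toNat, (3 / 14 : ℝ) ^ (i + 1) := by
    refine Finset.sum_nbij' (fun l => (m - l).toNat - 1) (fun i => m - 1 - i) ?_ ?_ ?_ ?_ ?_
    · intro l hl
      rw [Finset.mem_Ico] at hl
      rw [Finset.mem_range]
      omega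
    · intro i hi
      rw [Finset.mem_range] at hi
      rw [Finset.mem_Ico]
      omega
    · intro l hl
      rw [Finset.mem_Ico] at hl
      omega
    · intro i hi
      omega
    · intro l hl
      rw [Finset.mem_Ico] at hl
      congr 1
      omega
  have hgeom (M : ℕ) : ∑ i ∈ Finset.range M, (3 / 14 : ℝ) ^ (i + 1) =
      3 / 11 * (1 - (3 / 14) ^ M) := by
    induction M with
    | zero => simp
    | succ M ih =>
      rw [Finset.sum_range_succ, ih, pow_succ]
      ring
  rw [h, hgeom]
  have : (0 : ℝ) ≤ (3 / 14) ^ m.toNat := by positivity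
  linarith

theorem stmt16 (m n ℓ nt : ℤ) (hm : 6 ≤ m) (hn : m ≤ n) (hℓ0 : 0 ≤ ℓ) (hℓm : ℓ ≤ m)
    (hnt : 1 ≤ nt) (hnt2 : 4 * m * nt < m ^ 2) :
    ∑ ℓt ∈ (Finset.Ico (0 : ℤ) m).filter fun ℓt => 4 * m * nt - ℓt ^ 2 < 0,
        2 * (polarCoef m nt ℓt : ℝ) *
          ((ℓt ^ 2 - 4 * m * nt : ℤ) : ℝ) ^ ((23 : ℝ) / 4) *
          besselI (23 / 2)
            (Real.pi * Real.sqrt (((4 * m * n - ℓ ^ 2 : ℤ) : ℝ) *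
              ((ℓt ^ 2 - 4 * m * nt : ℤ) : ℝ)) / (m : ℝ)) <
      (0.23 : ℝ) * (polarCoef m nt m : ℝ) *
        ((m ^ 2 - 4 * m * nt : ℤ) : ℝ) ^ ((23 : ℝ) / 4) *
        besselI (23 / 2)
          (Real.pi * Real.sqrt (((4 * m * n - ℓ ^ 2 : ℤ) : ℝ) *
            ((m ^ 2 - 4 * m * nt : ℤ) : ℝ)) / (m : ℝ)) := by
  have hm0 : (0 : ℝ) < m := by exact_mod_cast (by omega : 0 < m)
  have hNm : 4 * nt < m := by nlinarith
  set Δ : ℝ := ((4 * m * n - ℓ ^ 2 : ℤ) : ℝ) with hΔ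
  have hΔ3 : 3 * (m : ℝ) ^ 2 ≤ Δ := by
    rw [hΔ]
    exact_mod_cast (by nlinarith : 3 * m ^ 2 ≤ 4 * m * n - ℓ ^ 2)
  have hΔ0 : 0 ≤ Δ := le_trans (by positivity) hΔ3
  set c : ℝ := Real.pi * √Δ / m with hc
  have hc53 : 53 / 10 ≤ c := le_pi_mul_sqrt_div hm0 hΔ3
  have hc0 : 0 < c := by linarith
  have harg (D : ℝ) : Real.pi * √(Δ * D) / m = c * √D := by
    rw [Real.sqrt_mul hΔ0, hc]
    ring
  simp only [harg]
  set K : ℝ := (c ^ ((23 : ℝ) / 2))⁻¹ with hK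
  have hK0 : 0 < K := by positivity
  set E : ℝ := ((m ^ 2 - 4 * m * nt : ℤ) : ℝ) with hE
  have hE0 : 0 < E := by
    rw [hE]
    exact_mod_cast (by linarith : 0 < m ^ 2 - 4 * m * nt)
  set W : ℝ := K * scaledBessel (c * √E) with hW
  have hW0 : 0 < W := mul_pos hK0 (scaledBessel_pos (mul_pos hc0 (Real.sqrt_pos.2 hE0)))
  set M : ℝ := (((m - 2 * nt) * dcoef nt ^ 2 : ℤ) : ℝ) with hM
  have hM0 : 0 < M := by
    have h1 := dcoef_pos (by omega : 0 ≤ nt)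
    have h2 : 0 < m - 2 * nt := by omega
    rw [hM]
    exact_mod_cast (by positivity : 0 < (m - 2 * nt) * dcoef nt ^ 2)
  have hterm : ∀ l ∈ (Finset.Ico (0 : ℤ) m).filter fun l => 4 * m * nt - l ^ 2 < 0,
      2 * (polarCoef m nt l : ℝ) * ((l ^ 2 - 4 * m * nt : ℤ) : ℝ) ^ ((23 : ℝ) / 4) *
        besselI (23 / 2) (c * √((l ^ 2 - 4 * m * nt : ℤ) : ℝ)) ≤
      52 / 75 * (M * W) * (3 / 14) ^ (m - l).toNat := by
    intro l hl
    rw [Finset.mem_filter, Finset.mem_Ico] at hl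
    obtain ⟨⟨hl0, hlm⟩, hD⟩ := hl
    obtain ⟨i, hi⟩ : ∃ i : ℕ, l = m - (i + 1 : ℕ) := ⟨(m - l).toNat - 1, by omega⟩
    have hj : (m - l).toNat = i + 1 := by omega
    have hD' : (0 : ℝ) < ((l ^ 2 - 4 * m * nt : ℤ) : ℝ) := by
      exact_mod_cast (by linarith : 0 < l ^ 2 - 4 * m * nt)
    have hpol : 25 * (polarCoef m nt l : ℝ) ≤ 26 * 3 ^ i * 14 ^ (i + 1) * M := by
      have h := polarCoef_sub_le (j := i + 1) hm hnt (by omega) (by omega) (by rw [← hi]; linarith)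
      rw [← hi, Nat.add_sub_cancel] at h
      rw [hM]
      exact_mod_cast h
    have hlR : (l : ℝ) = m - (i + 1 : ℕ) := by rw [hi]; push_cast; ring
    have hbes := scaledBessel_sqrt_le (c := c) (m := m) (D₁ := ((l ^ 2 - 4 * m * nt : ℤ) : ℝ))
      (D₂ := E) (j := i + 1) hc53 (by exact_mod_cast (by omega : ((i + 1 : ℕ) : ℤ) ≤ m)) hD'
      (by
        rw [← hlR]
        exact_mod_cast (by nlinarith : l ^ 2 - 4 * m * nt ≤ l ^ 2))
      (by rw [hE, ← hlR]; push_cast; ring)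
    have hpos := scaledBessel_pos (mul_pos hc0 (Real.sqrt_pos.2 hD'))
    rw [mul_assoc, rpow_mul_besselI_sqrt hc0 hD', ← hK, hj]
    calc 2 * (polarCoef m nt l : ℝ) * (K * scaledBessel (c * √((l ^ 2 - 4 * m * nt : ℤ) : ℝ)))
        ≤ 2 * (26 * 3 ^ i * 14 ^ (i + 1) * M / 25) *
          (K * ((1 / 196) ^ (i + 1) * scaledBessel (c * √E))) :=
          mul_le_mul (by linarith) (mul_le_mul_of_nonneg_left hbes hK0.le)
            (mul_pos hK0 hpos).le (by positivity)
      _ = 52 / 75 * (M * W) * (3 ^ (i + 1) * 14 ^ (i + 1) * (1 / 196) ^ (i + 1)) := by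
          rw [hW, pow_succ (3 : ℝ)]
          ring
      _ = _ := by
          rw [← mul_pow, ← mul_pow]
          norm_num
  have hpolm : M ≤ polarCoef m nt m := by
    rw [hM]
    exact_mod_cast le_polarCoef (by omega) hnt2
  have hMW : 0 < M * W := mul_pos hM0 hW0
  calc _ ≤ ∑ l ∈ (Finset.Ico (0 : ℤ) m).filter fun l => 4 * m * nt - l ^ 2 < 0,
        52 / 75 * (M * W) * (3 / 14) ^ (m - l).toNat := Finset.sum_le_sum hterm
    _ ≤ ∑ l ∈ Finset.Ico (0 : ℤ) m, 52 / 75 * (M * W) * (3 / 14) ^ (m - l).toNat :=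
        Finset.sum_le_sum_of_subset_of_nonneg (Finset.filter_subset _ _)
          fun _ _ _ => by positivity
    _ ≤ 52 / 75 * (M * W) * (3 / 11) := by
        rw [← Finset.mul_sum]
        exact mul_le_mul_of_nonneg_left (sum_geometric_le m) (by positivity)
    _ < 0.23 * (M * W) := by linarith
    _ ≤ 0.23 * ((polarCoef m nt m : ℝ) * W) := by gcongr
    _ = _ := by
        rw [mul_assoc (0.23 * (polarCoef m nt m : ℝ)), rpow_mul_besselI_sqrt hc0 hE0, ← hK, ← hW]
        ring
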